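/- Let T = A∘B be a closed operator on H with A ∈ L⁺(H) and B nonnegative selfadjoint (so T ∈ L²₊ and dom T = dom B). Then the operator T*∘B (with domain {x ∈ dom B : Bx ∈ dom T*}, x ↦ T*(Bx)) is nonnegative and selfadjoint and coincides with B∘T (domain {x ∈ dom B : Tx ∈ dom B}, x ↦ B(A(Bx))), and for every x ∈ dom B one has that ⟨Bx, Tx⟩ is real with 0 ≤ ‖Tx‖² ≤ ‖A‖·⟨Bx, Tx⟩. (Thus every T ∈ L²₊ satisfies the Sebestyén inequality T*T ≤ λ·T*B = λ·B*T with λ = ‖A‖ and Y = B as solution.) -/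

import Mathlib

open scoped ComplexOrder
noncomputable section

local notation "⟪" x ", " y "⟫" => @inner ℂ _ _ x y

section Toolkit

/-- Composition of partially defined linear maps:
`pcomp S T` has domain `{x ∈ dom T : T x ∈ dom S}` and maps `x ↦ S (T x)`. -/
def pcomp {R E F G : Type*} [CommRing R] [AddCommGroup E] [Module R E]
    [AddCommGroup F] [Module R F] [AddCommGroup G] [Module R G]
    (S : F →ₗ.[R] G) (T : E →ₗ.[R] F) : E →ₗ.[R] G where
  domain := (S.domain.comap T.toFun).map T.domain.subtype
  toFun := (S.toFun.comp (T.toFun.restrict (p := S.domain.comap T.toFun) (q := S.domain)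
      fun _ hx => hx)).comp
    (Submodule.equivMapOfInjective T.domain.subtype (Submodule.injective_subtype _)
      (S.domain.comap T.toFun)).symm.toLinearMap

/-- A bounded everywhere-defined operator viewed as a `LinearPMap` with domain `⊤`. -/
def ofCLM {E F : Type*} [NormedAddCommGroup E] [NormedAddCommGroup F]
    [NormedSpace ℂ E] [NormedSpace ℂ F] (X : E →L[ℂ] F) : E →ₗ.[ℂ] F :=
  (X : E →ₗ[ℂ] F).toPMap ⊤

variable {H : Type*} [NormedAddCommGroup H] [InnerProductSpace ℂ H] [CompleteSpace H]

/-- `B` is nonnegative selfadjoint: densely defined, `B* = B`, and `⟪Bx, x⟫ ≥ 0` on `dom B`. -/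
def IsNonnegSelfAdjoint (B : H →ₗ.[ℂ] H) : Prop :=
  Dense (B.domain : Set H) ∧ B.adjoint = B ∧ ∀ x : B.domain, 0 ≤ ⟪B x, (x : H)⟫

/-- `C` is a selfadjoint partial operator: densely defined with `C* = C`. -/
def IsSelfAdjointPMap (C : H →ₗ.[ℂ] H) : Prop :=
  Dense (C.domain : Set H) ∧ C.adjoint = C

/-- A quasi-affinity: an injective bounded everywhere-defined operator with dense range. -/
def IsQuasiAffinity (G : H →L[ℂ] H) : Prop :=
  Function.Injective G ∧ DenseRange G

end Toolkit

theorem mem_graph_pcomp {R E F G : Type*} [CommRing R] [AddCommGroup E] [Module R E]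
    [AddCommGroup F] [Module R F] [AddCommGroup G] [Module R G]
    (S : F →ₗ.[R] G) (T : E →ₗ.[R] F) (x : E) (z : G) :
    (x, z) ∈ (pcomp S T).graph ↔ ∃ y, (x, y) ∈ T.graph ∧ (y, z) ∈ S.graph := by
  have apply_eq (u : S.domain.comap T.toFun) (h : (u : E) ∈ (pcomp S T).domain) :
      pcomp S T ⟨u, h⟩ = S ⟨T u, u.2⟩ := by
    have hu : (Submodule.equivMapOfInjective T.domain.subtype
        (Submodule.injective_subtype _) (S.domain.comap T.toFun)).symm ⟨u, h⟩ = u := by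
      rw [LinearEquiv.symm_apply_eq]
      rfl
    change S.toFun _ = S.toFun _
    congr 1
    exact congrArg (T.toFun.restrict (p := S.domain.comap T.toFun) (q := S.domain) _) hu
  simp only [LinearPMap.mem_graph_iff]
  constructor
  · rintro ⟨⟨_, hx⟩, rfl, rfl⟩
    obtain ⟨u, hu, rfl⟩ := id hx
    exact ⟨T u, ⟨u, rfl, rfl⟩, ⟨T u, hu⟩, rfl, (apply_eq ⟨u, hu⟩ hx).symm⟩
  · rintro ⟨_, ⟨u, rfl, rfl⟩, ⟨v, hv⟩, hvu, rfl⟩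
    obtain rfl : v = T u := hvu
    exact ⟨⟨u, u, hv, rfl⟩, rfl, apply_eq ⟨u, hv⟩ _⟩

section

variable {H : Type*} [NormedAddCommGroup H] [InnerProductSpace ℂ H]

theorem mem_graph_pcomp_ofCLM (A : H →L[ℂ] H) (B : H →ₗ.[ℂ] H) (x z : H) :
    (x, z) ∈ (pcomp (ofCLM A) B).graph ↔ ∃ y, (x, y) ∈ B.graph ∧ A y = z := by
  have (y : H) : (y, z) ∈ (ofCLM A).graph ↔ A y = z := by
    rw [LinearPMap.mem_graph_iff]
    exact ⟨by rintro ⟨u, rfl, h⟩; exact h, fun h => ⟨⟨y, trivial⟩, rfl, h⟩⟩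
  simp only [mem_graph_pcomp, this]

variable [CompleteSpace H]

theorem LinearPMap.mem_graph_adjoint_iff {T : H →ₗ.[ℂ] H} (hT : Dense (T.domain : Set H))
    (y z : H) : (y, z) ∈ T.adjoint.graph ↔ ∀ a b, (a, b) ∈ T.graph → ⟪b, y⟫ = ⟪a, z⟫ := by
  simp only [LinearPMap.adjoint_graph_eq_graph_adjoint hT, Submodule.mem_adjoint_iff, sub_eq_zero]

/-- A nonnegative symmetric operator `D` such that `1 + D` is surjective is selfadjoint. -/
theorem isNonnegSelfAdjoint_of_surjective {D : H →ₗ.[ℂ] H}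
    (hsymm : ∀ x y u v, (x, y) ∈ D.graph → (u, v) ∈ D.graph → ⟪y, u⟫ = ⟪x, v⟫)
    (hnonneg : ∀ x y, (x, y) ∈ D.graph → 0 ≤ ⟪y, x⟫)
    (hsurj : ∀ h, ∃ x, (x, h - x) ∈ D.graph) : IsNonnegSelfAdjoint D := by
  have hdense : Dense (D.domain : Set H) := by
    rw [Submodule.dense_iff_topologicalClosure_eq_top,
      Submodule.topologicalClosure_eq_top_iff, Submodule.eq_bot_iff]
    intro z hz
    obtain ⟨x, hx⟩ := hsurj z
    have horth : ⟪z, x⟫ = 0 :=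
      Submodule.inner_left_of_mem_orthogonal (LinearPMap.mem_domain_of_mem_graph hx) hz
    have hpos := hnonneg _ _ hx
    rw [inner_sub_left, horth, zero_sub, Left.nonneg_neg_iff] at hpos
    have hx0 : x = 0 := by
      rw [← re_inner_self_nonpos (𝕜 := ℂ)]
      exact (Complex.le_def.1 hpos).1
    subst hx0
    simpa using (LinearPMap.graph_fst_eq_zero_snd _ hx rfl)
  refine ⟨hdense, LinearPMap.eq_of_eq_graph (le_antisymm ?_ ?_),
    fun x => hnonneg _ _ (D.mem_graph x)⟩
  · rintro ⟨y, z⟩ hyz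
    rw [LinearPMap.mem_graph_adjoint_iff hdense] at hyz
    obtain ⟨x, hx⟩ := hsurj (y + z)
    have hyx : y - x = 0 := by
      obtain ⟨u, hu⟩ := hsurj (y - x)
      have h1 := hyz _ _ hu
      have h2 := hsymm _ _ _ _ hu hx
      rw [← inner_self_eq_zero (𝕜 := ℂ)]
      simp only [inner_sub_left, inner_sub_right, inner_add_right] at h1 h2 ⊢
      linear_combination h1 - h2
    obtain rfl := sub_eq_zero.1 hyx
    simpa using hx
  · rintro ⟨y, z⟩ hyz
    rw [LinearPMap.mem_graph_adjoint_iff hdense]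
    exact fun a b hab => hsymm _ _ _ _ hab hyz

theorem ContinuousLinearMap.IsPositive.exists_isSelfAdjoint_sq {A : H →L[ℂ] H}
    (hA : A.IsPositive) : ∃ S : H →L[ℂ] H, IsSelfAdjoint S ∧ S * S = A :=
  have hA' : 0 ≤ A := (ContinuousLinearMap.nonneg_iff_isPositive A).2 hA
  ⟨CFC.sqrt A, (CFC.sqrt_nonneg A).isSelfAdjoint, CFC.sqrt_mul_sqrt_self A hA'⟩

theorem isClosed_pcomp_ofCLM_of_mul_self {S : H →L[ℂ] H} (hS : IsSelfAdjoint S)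
    {B : H →ₗ.[ℂ] H} (hT : (pcomp (ofCLM (S * S)) B).IsClosed) :
    (pcomp (ofCLM S) B).IsClosed := by
  have hsymm (x y : H) : ⟪S x, y⟫ = ⟪x, S y⟫ := hS.isSymmetric x y
  refine isClosed_of_closure_subset fun ⟨x, y⟩ hxy => ?_
  have hST : (x, S y) ∈ (pcomp (ofCLM (S * S)) B).graph := by
    rw [← SetLike.mem_coe, ← hT.closure_eq]
    refine map_mem_closure (f := fun p : H × H => (p.1, S p.2)) (by fun_prop) hxy ?_
    rintro ⟨u, v⟩ huv
    obtain ⟨b, hb, rfl⟩ := (mem_graph_pcomp_ofCLM _ _ _ _).1 huv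
    exact (mem_graph_pcomp_ofCLM _ _ _ _).2 ⟨b, hb, rfl⟩
  obtain ⟨b, hb, hbS⟩ := (mem_graph_pcomp_ofCLM _ _ _ _).1 hST
  refine (mem_graph_pcomp_ofCLM _ _ _ _).2 ⟨b, hb, ?_⟩
  have hker : S (S b - y) = 0 := by
    rw [map_sub, sub_eq_zero]
    exact hbS
  have hy : y ∈ closure (Set.range S) := by
    refine map_mem_closure (f := Prod.snd) continuous_snd hxy ?_
    rintro ⟨u, v⟩ huv
    obtain ⟨c, -, rfl⟩ := (mem_graph_pcomp_ofCLM _ _ _ _).1 huv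
    exact ⟨c, rfl⟩
  have horth (v : H) (hv : v ∈ closure (Set.range S)) : ⟪S b - y, v⟫ = 0 := by
    refine closure_minimal (t := {v | ⟪S b - y, v⟫ = 0}) ?_
      (isClosed_eq (by fun_prop) continuous_const) hv
    rintro _ ⟨c, rfl⟩
    change ⟪S b - y, S c⟫ = 0
    rw [← hsymm, hker, inner_zero_left]
  rw [← sub_eq_zero, ← inner_self_eq_zero (𝕜 := ℂ), inner_sub_right, horth y hy,
    horth _ (subset_closure ⟨b, rfl⟩), sub_zero]

/-- If `C` is closed then every `h` splits as `x + w`, where `w` acts as `C* C x`. -/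
theorem LinearPMap.IsClosed.exists_inner_eq {C : H →ₗ.[ℂ] H} (hC : C.IsClosed) (h : H) :
    ∃ x y, (x, y) ∈ C.graph ∧ ∀ u v, (u, v) ∈ C.graph → ⟪v, y⟫ = ⟪u, h - x⟫ := by
  let K : Submodule ℂ (WithLp 2 (H × H)) :=
    C.graph.comap (WithLp.linearEquiv 2 ℂ (H × H)).toLinearMap
  have hK : _root_.IsClosed (K : Set (WithLp 2 (H × H))) :=
    _root_.IsClosed.preimage (WithLp.prod_continuous_ofLp 2 H H) hC
  have : CompleteSpace K := hK.completeSpace_coe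
  obtain ⟨p, hp, hperp⟩ := Submodule.HasOrthogonalProjection.exists_orthogonal (K := K)
    (WithLp.toLp 2 (h, 0))
  refine ⟨p.fst, p.snd, hp, fun u v huv => ?_⟩
  have horth := (Submodule.mem_orthogonal _ _).1 hperp (WithLp.toLp 2 (u, v)) huv
  simp only [WithLp.prod_inner_apply] at horth
  simp only [WithLp.ofLp_sub, Prod.fst_sub, Prod.snd_sub, zero_sub, inner_neg_right] at horth
  exact (add_neg_eq_zero.1 horth).symm

end

/-- every `T = A ∘ B ∈ L²₊` (A ∈ L⁺(H), B nonnegative selfadjoint) satisfies the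
Sebestyén inequality: `T* ∘ B` is nonnegative selfadjoint and equals `B ∘ T`, and for all
`x ∈ dom B` the number `⟪Bx, Tx⟫ = ⟪Bx, A(Bx)⟫` is real with `0 ≤ ‖Tx‖² ≤ ‖A‖·⟪Bx, Tx⟫`. -/
theorem statement8
    {H : Type*} [NormedAddCommGroup H] [InnerProductSpace ℂ H] [CompleteSpace H]
    (A : H →L[ℂ] H) (hA : A.IsPositive)
    (B : H →ₗ.[ℂ] H) (hB : IsNonnegSelfAdjoint B)
    (hT : (pcomp (ofCLM A) B).IsClosed) :
    IsNonnegSelfAdjoint (pcomp (pcomp (ofCLM A) B).adjoint B) ∧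
    pcomp (pcomp (ofCLM A) B).adjoint B = pcomp B (pcomp (ofCLM A) B) ∧
    ∀ x : B.domain,
      0 ≤ ⟪B x, A (B x)⟫ ∧
      ‖A (B x)‖ ^ 2 ≤ ‖A‖ * (⟪B x, A (B x)⟫).re := by
  obtain ⟨S, hS, rfl⟩ := hA.exists_isSelfAdjoint_sq
  have hsymm (x y : H) : ⟪S x, y⟫ = ⟪x, S y⟫ := hS.isSymmetric x y
  obtain ⟨hdense, hadj, -⟩ := hB
  have hBgraph (y z : H) : (y, z) ∈ B.graph ↔ ∀ a b, (a, b) ∈ B.graph → ⟪b, y⟫ = ⟪a, z⟫ := by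
    rw [← LinearPMap.mem_graph_adjoint_iff hdense, hadj]
  have hTdense : Dense ((pcomp (ofCLM (S * S)) B).domain : Set H) := by
    refine hdense.mono fun x hx => ?_
    exact LinearPMap.mem_domain_of_mem_graph
      ((mem_graph_pcomp_ofCLM _ _ _ _).2 ⟨_, B.mem_graph ⟨x, hx⟩, rfl⟩)
  have hTadj (y z : H) : (y, z) ∈ (pcomp (ofCLM (S * S)) B).adjoint.graph ↔
      (S (S y), z) ∈ B.graph := by
    rw [LinearPMap.mem_graph_adjoint_iff hTdense, hBgraph]
    simp only [mem_graph_pcomp_ofCLM, ← hsymm]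
    exact ⟨fun h a b hab => h a _ ⟨b, hab, rfl⟩, by rintro h a _ ⟨b, hab, rfl⟩; exact h a b hab⟩
  have hD (x z : H) : (x, z) ∈ (pcomp (pcomp (ofCLM (S * S)) B).adjoint B).graph ↔
      ∃ y, (x, y) ∈ B.graph ∧ (S (S y), z) ∈ B.graph := by
    simp only [mem_graph_pcomp, hTadj]
  refine ⟨isNonnegSelfAdjoint_of_surjective ?_ ?_ ?_, LinearPMap.eq_of_eq_graph ?_, fun x => ?_⟩
  · intro x y u v hxy huv
    obtain ⟨b, hb, hby⟩ := (hD _ _).1 hxy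
    obtain ⟨c, hc, hcv⟩ := (hD _ _).1 huv
    rw [(hBgraph _ _).1 hc _ _ hby, ← (hBgraph _ _).1 hcv _ _ hb, hsymm, hsymm]
  · intro x y hxy
    obtain ⟨b, hb, hby⟩ := (hD _ _).1 hxy
    rw [(hBgraph _ _).1 hb _ _ hby, hsymm, inner_self_eq_norm_sq_to_K]
    exact Complex.zero_le_real.2 (sq_nonneg ‖S b‖) |>.trans_eq (by norm_cast)
  · intro h
    obtain ⟨x, y, hxy, horth⟩ := (isClosed_pcomp_ofCLM_of_mul_self hS hT).exists_inner_eq h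
    obtain ⟨b, hb, rfl⟩ := (mem_graph_pcomp_ofCLM _ _ _ _).1 hxy
    refine ⟨x, (hD _ _).2 ⟨b, hb, (hBgraph _ _).2 fun u v huv => ?_⟩⟩
    rw [← hsymm]
    exact horth _ _ ((mem_graph_pcomp_ofCLM _ _ _ _).2 ⟨v, huv, rfl⟩)
  · ext ⟨x, z⟩
    rw [hD, mem_graph_pcomp]
    simp only [mem_graph_pcomp_ofCLM]
    exact ⟨fun ⟨y, hy, hz⟩ => ⟨_, ⟨y, hy, rfl⟩, hz⟩,
      by rintro ⟨_, ⟨y, hy, rfl⟩, hz⟩; exact ⟨y, hy, hz⟩⟩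
  · have hinner : ⟪B x, (S * S) (B x)⟫ = ((‖S (B x)‖ ^ 2 : ℝ) : ℂ) := by
      rw [mul_apply_eq_comp, ← hsymm, inner_self_eq_norm_sq_to_K]
      norm_cast
    have hnorm : ‖S * S‖ = ‖S‖ ^ 2 := by
      rw [sq, ← CStarRing.norm_star_mul_self (x := S), hS.star_eq]
    rw [hinner, hnorm, Complex.ofReal_re, ← mul_pow]
    refine ⟨Complex.zero_le_real.2 (sq_nonneg _), ?_⟩
    exact pow_le_pow_left₀ (norm_nonneg _) (S.le_opNorm _) 2
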